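/- arXiv:1210.6256 — 2 statements merged into one kernel-verified Lean document; each statement's English description precedes it below -/
import Mathlib

section
/- Let K be a nondegenerate tetrahedron in ℝ³ with vertices v₁,…,v₄ and barycentric coordinates λ₁,…,λ₄, let i, j, k, l be a permutation of 1,2,3,4, let e be the edge with endpoints v_k and v_l, and let β, γ ∈ ℝ. Then the quadratic polynomial p = β λ_k² + (β+γ) λ_k λ_l + γ λ_l² + (3/2)(β+γ)(λ_i² + λ_j²) + (−5β−γ)(λ_i+λ_j)λ_k + (−β−5γ)(λ_i+λ_j)λ_l + 3(β+γ) λ_i λ_j satisfies: (1) p restricted to e is affine; (2) p(v_k) = β and p(v_l) = γ; (3) ∫_{f_i} p q ds = 0 and ∫_{f_j} p q ds = 0 for every affine function q, where f_i, f_j are the faces opposite v_i, v_j; (4) ∫_K p dx = 0; and moreover p(v_i) = p(v_j) = 3(β+γ)/2. -/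
open MeasureTheory RealInnerProductSpace Matrix

noncomputable section

abbrev E3 := EuclideanSpace ℝ (Fin 3)

/-- `p` agrees with an affine function on the set `s`. -/
def AffineOn (s : Set E3) (p : E3 → ℝ) : Prop :=
  ∃ q : E3 →ᵃ[ℝ] ℝ, ∀ x ∈ s, p x = q x

def Tet (v : Fin 4 → E3) : Set E3 := convexHull ℝ (Set.range v)

def Face (v : Fin 4 → E3) (i : Fin 4) : Set E3 := convexHull ℝ (v '' {j | j ≠ i})

def Edge (v : Fin 4 → E3) (k l : Fin 4) : Set E3 := segment ℝ (v k) (v l)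

lemma key {W : Type*} [NormedAddCommGroup W] [NormedSpace ℝ W] [MeasurableSpace W] [BorelSpace W]
    [FiniteDimensional ℝ W] (ν : Measure W) [ν.IsAddHaarMeasure] (μ : Measure E3)
    [μ.IsAddLeftInvariant] (L : W →ₗ[ℝ] E3) (a : E3) (hL : Function.Injective L)
    (hfin : ∀ K, IsCompact K → μ ((fun w => a + L w) '' K) < ⊤)
    (S : Set W) (f : E3 → ℝ)
    (h : ∫ w in S, f (a + L w) ∂ν = 0) :
    ∫ x in (fun w => a + L w) '' S, f x ∂μ = 0 := by
  have : ProperSpace W := FiniteDimensional.proper ℝ W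
  set Φ : W → E3 := fun w => a + L w with hΦ
  have hLc : Continuous L := L.continuous_of_finiteDimensional
  have hc : Continuous Φ := by fun_prop
  have hi : Function.Injective Φ := fun x y hxy => hL (by simpa [hΦ] using hxy)
  have hm : MeasurableEmbedding Φ := hc.measurableEmbedding hi
  set ρ := μ.comap Φ with hρ
  have : IsFiniteMeasureOnCompacts ρ := ⟨fun K hK => by
    rw [hρ, hm.comap_apply]; exact hfin K hK⟩
  have : ρ.IsAddLeftInvariant := by
    refine ⟨fun g => ?_⟩
    ext s hs
    rw [Measure.map_apply (measurable_const_add g) hs, hρ, hm.comap_apply, hm.comap_apply]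
    have : Φ '' ((fun x => g + x) ⁻¹' s) = (fun x => L g + x) ⁻¹' (Φ '' s) := by
      ext x
      constructor
      · rintro ⟨w, hw, rfl⟩
        exact ⟨g + w, hw, by simp [hΦ]; abel⟩
      · rintro ⟨w, hw, hx⟩
        refine ⟨-g + w, by simpa using hw, ?_⟩
        simp only [hΦ] at hx ⊢
        rw [map_add, map_neg]
        rw [show x = -(L g) + (L g + x) by abel, ← hx]; abel
    rw [this, measure_preimage_add]
  have e := Measure.isAddLeftInvariant_eq_smul ρ ν
  have h1 : ∫ x in Φ '' S, f x ∂(Measure.map Φ ρ) = 0 := by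
    rw [hm.setIntegral_map, hi.preimage_image, e, Measure.restrict_smul,
      integral_smul_nnreal_measure, h, smul_zero]
  rwa [hρ, hm.map_comap, Measure.restrict_restrict_of_subset (Set.image_subset_range _ _)] at h1

lemma int1 (c0 c1 c2 c3 c4 c5 s : ℝ) :
    ∫ y in (0:ℝ)..s, (c0 + c1 * y + c2 * y ^ 2 + c3 * y ^ 3 + c4 * y ^ 4 + c5 * y ^ 5) =
    c0 * s + c1 * s ^ 2 / 2 + c2 * s ^ 3 / 3 + c3 * s ^ 4 / 4 + c4 * s ^ 5 / 5 + c5 * s ^ 6 / 6 := by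
  rw [intervalIntegral.integral_eq_sub_of_hasDerivAt
    (f := fun s => c0 * s + c1 * s ^ 2 / 2 + c2 * s ^ 3 / 3 + c3 * s ^ 4 / 4 + c4 * s ^ 5 / 5
      + c5 * s ^ 6 / 6)]
  · simp
  · intro x _
    have h (n : ℕ) (c : ℝ) := (((hasDerivAt_pow n x).const_mul c).div_const (n : ℝ))
    have := ((((((hasDerivAt_id x).const_mul c0).add (h 2 c1)).add (h 3 c2)).add (h 4 c3)).add
      (h 5 c4)).add (h 6 c5)
    convert this using 1
    · ext t; simp
    · push_cast; simp; ring
  · exact Continuous.intervalIntegrable (by fun_prop) _ _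

lemma slice {Y : Type*} [MeasureSpace Y] [SFinite (volume : Measure Y)] (s : ℝ) (hs : 0 ≤ s)
    (T : Set (ℝ × Y)) (hT : MeasurableSet T) (R : ℝ → Set Y)
    (hR : ∀ x y, (x, y) ∈ T ↔ (x ∈ Set.Icc 0 s ∧ y ∈ R x)) (hRm : ∀ x, MeasurableSet (R x))
    (f : ℝ × Y → ℝ) (hf : IntegrableOn f T) :
    ∫ w in T, f w = ∫ x in (0:ℝ)..s, ∫ y in R x, f (x, y) := by
  rw [← integral_indicator hT, Measure.volume_eq_prod, integral_prod _
    (by rw [← Measure.volume_eq_prod, integrable_indicator_iff hT]; exact hf)]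
  rw [intervalIntegral.integral_of_le hs, ← integral_Icc_eq_integral_Ioc,
    ← integral_indicator measurableSet_Icc]
  congr 1; ext x
  by_cases hx : x ∈ Set.Icc 0 s
  · rw [Set.indicator_of_mem hx, ← integral_indicator (hRm x)]
    congr 1; ext y
    by_cases hy : y ∈ R x
    · rw [Set.indicator_of_mem hy, Set.indicator_of_mem ((hR x y).2 ⟨hx, hy⟩)]
    · rw [Set.indicator_of_notMem hy, Set.indicator_of_notMem (fun h => hy ((hR x y).1 h).2)]
  · rw [Set.indicator_of_notMem hx]
    rw [← integral_zero Y ℝ (μ := volume)]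
    congr 1; ext y
    rw [Set.indicator_of_notMem (fun h => hx ((hR x y).1 h).1)]

def T2 (s : ℝ) : Set (ℝ × ℝ) := {w | 0 ≤ w.1 ∧ 0 ≤ w.2 ∧ w.1 + w.2 ≤ s}
def T3 : Set (ℝ × ℝ × ℝ) := {w | 0 ≤ w.1 ∧ 0 ≤ w.2.1 ∧ 0 ≤ w.2.2 ∧ w.1 + w.2.1 + w.2.2 ≤ 1}

lemma T2_compact (s : ℝ) : IsCompact (T2 s) := by
  have hc : IsClosed (T2 s) := by
    simp only [T2, Set.ofPred_and]
    refine (isClosed_le ?_ ?_).inter ((isClosed_le ?_ ?_).inter (isClosed_le ?_ ?_)) <;> fun_prop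
  refine (isCompact_Icc (a := (0, 0)) (b := (s, s))).of_isClosed_subset hc ?_
  rintro ⟨x, y⟩ ⟨h1, h2, h3⟩
  simp only at h1 h2 h3
  refine ⟨⟨h1, h2⟩, ⟨?_, ?_⟩⟩ <;> simp only <;> linarith

lemma T3_compact : IsCompact T3 := by
  have hc : IsClosed T3 := by
    simp only [T3, Set.ofPred_and]
    refine (isClosed_le ?_ ?_).inter ((isClosed_le ?_ ?_).inter
      ((isClosed_le ?_ ?_).inter (isClosed_le ?_ ?_))) <;> fun_prop
  refine (isCompact_Icc (a := (0, 0, 0)) (b := (1, 1, 1))).of_isClosed_subset hc ?_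
  rintro ⟨x, y, z⟩ ⟨h1, h2, h3, h4⟩
  simp only at h1 h2 h3 h4
  refine ⟨⟨h1, h2, h3⟩, ⟨?_, ?_, ?_⟩⟩ <;> simp only <;> linarith

lemma int2 (s : ℝ) (hs : 0 ≤ s) (f : ℝ × ℝ → ℝ) (hf : Continuous f) :
    ∫ w in T2 s, f w = ∫ x in (0:ℝ)..s, ∫ y in (0:ℝ)..(s - x), f (x, y) := by
  rw [slice s hs (T2 s) (T2_compact s).measurableSet (fun x => Set.Icc 0 (s - x)) ?_
    (fun x => measurableSet_Icc) f (hf.continuousOn.integrableOn_compact (T2_compact s))]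
  · apply intervalIntegral.integral_congr
    intro x hx
    rw [Set.uIcc_of_le hs] at hx
    simp only
    rw [intervalIntegral.integral_of_le (by linarith [hx.2]), integral_Icc_eq_integral_Ioc]
  · intro x y
    simp only [T2, Set.mem_ofPred_eq, Set.mem_Icc]
    constructor
    · rintro ⟨h1, h2, h3⟩; refine ⟨⟨?_, ?_⟩, ?_, ?_⟩ <;> linarith
    · rintro ⟨⟨h1, h2⟩, h3, h4⟩; refine ⟨?_, ?_, ?_⟩ <;> linarith

lemma int3 (f : ℝ × ℝ × ℝ → ℝ) (hf : Continuous f) :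
    ∫ w in T3, f w = ∫ x in (0:ℝ)..1, ∫ y in (0:ℝ)..(1 - x), ∫ z in (0:ℝ)..(1 - x - y),
      f (x, y, z) := by
  rw [slice 1 zero_le_one T3 T3_compact.measurableSet (fun x => T2 (1 - x)) ?_
    (fun x => (T2_compact _).measurableSet) f (hf.continuousOn.integrableOn_compact T3_compact)]
  · apply intervalIntegral.integral_congr
    intro x hx
    rw [Set.uIcc_of_le zero_le_one] at hx
    simp only
    rw [int2 (1 - x) (by linarith [hx.2]) (fun w => f (x, w)) (by fun_prop)]
  · rintro x ⟨y, z⟩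
    simp only [T2, T3, Set.mem_ofPred_eq, Set.mem_Icc]
    constructor
    · rintro ⟨h1, h2, h3, h4⟩; refine ⟨⟨?_, ?_⟩, ?_, ?_, ?_⟩ <;> linarith
    · rintro ⟨⟨h1, h2⟩, h3, h4, h5⟩; refine ⟨?_, ?_, ?_, ?_⟩ <;> linarith

lemma hull2 : convexHull ℝ {((0:ℝ), (0:ℝ)), (1, 0), (0, 1)} = T2 1 := by
  apply subset_antisymm
  · apply convexHull_min
    · rintro w (rfl | rfl | rfl) <;> simp [T2]
    · rintro ⟨x, y⟩ ⟨h1, h2, h3⟩ ⟨x', y'⟩ ⟨h1', h2', h3'⟩ a b ha hb hab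
      simp only at h1 h2 h3 h1' h2' h3'
      refine ⟨?_, ?_, ?_⟩ <;> simp only [Prod.smul_mk, Prod.mk_add_mk, smul_eq_mul]
      · positivity
      · positivity
      · nlinarith [mul_le_mul_of_nonneg_left h3 ha, mul_le_mul_of_nonneg_left h3' hb]
  · rintro ⟨x, y⟩ ⟨h1, h2, h3⟩
    simp only at h1 h2 h3
    have := (convex_convexHull ℝ {((0:ℝ), (0:ℝ)), (1, 0), (0, 1)}).sum_mem
      (t := Finset.univ) (w := ![1 - x - y, x, y]) (z := ![(0, 0), (1, 0), (0, 1)]) ?_ ?_ ?_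
    · simpa [Fin.sum_univ_three] using this
    · intro i _; fin_cases i <;> simp <;> linarith
    · simp [Fin.sum_univ_three]; ring
    · intro i _; apply subset_convexHull; fin_cases i <;> simp

lemma hull3 : convexHull ℝ {((0:ℝ), (0:ℝ), (0:ℝ)), (1, 0, 0), (0, 1, 0), (0, 0, 1)} = T3 := by
  apply subset_antisymm
  · apply convexHull_min
    · rintro w (rfl | rfl | rfl | rfl) <;> simp [T3]
    · rintro ⟨x, y, z⟩ ⟨h1, h2, h3, h4⟩ ⟨x', y', z'⟩ ⟨h1', h2', h3', h4'⟩ a b ha hb hab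
      simp only at h1 h2 h3 h4 h1' h2' h3' h4'
      refine ⟨?_, ?_, ?_, ?_⟩ <;> simp only [Prod.smul_mk, Prod.mk_add_mk, smul_eq_mul]
      · positivity
      · positivity
      · positivity
      · nlinarith [mul_le_mul_of_nonneg_left h4 ha, mul_le_mul_of_nonneg_left h4' hb]
  · rintro ⟨x, y, z⟩ ⟨h1, h2, h3, h4⟩
    simp only at h1 h2 h3 h4
    have := (convex_convexHull ℝ {((0:ℝ), (0:ℝ), (0:ℝ)), (1, 0, 0), (0, 1, 0), (0, 0, 1)}).sum_mem
      (t := Finset.univ) (w := ![1 - x - y - z, x, y, z])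
      (z := ![(0, 0, 0), (1, 0, 0), (0, 1, 0), (0, 0, 1)]) ?_ ?_ ?_
    · simpa [Fin.sum_univ_four] using this
    · intro i _; fin_cases i <;> simp <;> linarith
    · simp [Fin.sum_univ_four]; ring
    · intro i _; apply subset_convexHull; fin_cases i <;> simp

lemma aff_eval (q : E3 →ᵃ[ℝ] ℝ) (a w : E3) : q (a + w) = q a + q.linear w := by
  have := q.map_vadd a w
  simp only [vadd_eq_add] at this
  rw [add_comm a, this, add_comm]

lemma lin_sub (q : E3 →ᵃ[ℝ] ℝ) (a b : E3) : q.linear (b - a) = q b - q a := by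
  simpa using q.linearMap_vsub b a

def L2 (a b c : E3) : ℝ × ℝ →ₗ[ℝ] E3 :=
  (LinearMap.fst ℝ ℝ ℝ).smulRight (b - a) + (LinearMap.snd ℝ ℝ ℝ).smulRight (c - a)

def L3 (a b c d : E3) : ℝ × ℝ × ℝ →ₗ[ℝ] E3 :=
  (LinearMap.fst ℝ ℝ (ℝ × ℝ)).smulRight (b - a) + (L2 a c d) ∘ₗ (LinearMap.snd ℝ ℝ (ℝ × ℝ))

lemma q_L2 (q : E3 →ᵃ[ℝ] ℝ) (a b c : E3) (w : ℝ × ℝ) :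
    q (a + L2 a b c w) = q a + w.1 * (q b - q a) + w.2 * (q c - q a) := by
  rw [aff_eval]; simp [L2, ← lin_sub, add_assoc]

lemma q_L3 (q : E3 →ᵃ[ℝ] ℝ) (a b c d : E3) (w : ℝ × ℝ × ℝ) :
    q (a + L3 a b c d w) =
      q a + w.1 * (q b - q a) + w.2.1 * (q c - q a) + w.2.2 * (q d - q a) := by
  rw [aff_eval]; simp [L3, L2, ← lin_sub, add_assoc]

lemma image2 (a b c : E3) : (fun w => a + L2 a b c w) '' T2 1 = convexHull ℝ {a, b, c} := by
  have := AffineMap.image_convexHull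
    (AffineMap.const ℝ (ℝ × ℝ) a + (L2 a b c).toAffineMap) {((0:ℝ), (0:ℝ)), (1, 0), (0, 1)}
  rw [hull2, AffineMap.coe_add] at this
  simpa [Pi.add_def, Set.image_insert_eq, L2, Function.comp_def] using this

lemma image3 (a b c d : E3) :
    (fun w => a + L3 a b c d w) '' T3 = convexHull ℝ {a, b, c, d} := by
  have := AffineMap.image_convexHull
    (AffineMap.const ℝ (ℝ × ℝ × ℝ) a + (L3 a b c d).toAffineMap)
    {((0:ℝ), (0:ℝ), (0:ℝ)), (1, 0, 0), (0, 1, 0), (0, 0, 1)}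
  rw [hull3, AffineMap.coe_add] at this
  simpa [Pi.add_def, Set.image_insert_eq, L3, L2, Function.comp_def] using this

instance : (volume : Measure (ℝ × ℝ)).IsAddHaarMeasure := by
  rw [Measure.volume_eq_prod]; infer_instance
instance : (volume : Measure (ℝ × ℝ × ℝ)).IsAddHaarMeasure := by
  rw [Measure.volume_eq_prod]; infer_instance


lemma poly2 (b g A B C : ℝ) :
    ∫ x in (0:ℝ)..1, ∫ y in (0:ℝ)..(1 - x),
      (b * x ^ 2 + (b + g) * x * y + g * y ^ 2 + 3 / 2 * (b + g) * (1 - x - y) ^ 2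
        + (-5 * b - g) * (1 - x - y) * x + (-b - 5 * g) * (1 - x - y) * y)
        * (A + B * x + C * y) = 0 := by
  have h1 : ∀ x : ℝ, ∫ y in (0:ℝ)..(1 - x),
      (b * x ^ 2 + (b + g) * x * y + g * y ^ 2 + 3 / 2 * (b + g) * (1 - x - y) ^ 2
        + (-5 * b - g) * (1 - x - y) * x + (-b - 5 * g) * (1 - x - y) * y)
        * (A + B * x + C * y) = _ := fun x => by
    refine Eq.trans (intervalIntegral.integral_congr fun y _ => ?_) (int1
      ((3/2)*g*A + (3/2)*b*A + (3/2)*x*g*B + (-4)*x*g*A + (3/2)*x*b*B + (-8)*x*b*A + (-4)*x^2*g*B + (5/2)*x^2*g*A + (-8)*x^2*b*B + (15/2)*x^2*b*A + (5/2)*x^3*g*B + (15/2)*x^3*b*B) ((3/2)*g*C + (-8)*g*A + (3/2)*b*C + (-4)*b*A + (-4)*x*g*C + (-8)*x*g*B + 10*x*g*A + (-8)*x*b*C + (-4)*x*b*B + 10*x*b*A + (5/2)*x^2*g*C + 10*x^2*g*B + (15/2)*x^2*b*C + 10*x^2*b*B) ((-8)*g*C + (15/2)*g*A + (-4)*b*C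 + (5/2)*b*A + 10*x*g*C + (15/2)*x*g*B + 10*x*b*C + (5/2)*x*b*B) ((15/2)*g*C + (5/2)*b*C) (0) (0) (1 - x))
    ring
  simp only [h1]
  refine Eq.trans (intervalIntegral.integral_congr fun x _ => ?_) ((int1
      ((-1/24)*g*C + (1/24)*b*C + (1/3)*b*A) ((1/3)*g*C + (-2/3)*b*C + (1/3)*b*B + (-3)*b*A) ((-3/4)*g*C + (9/4)*b*C + (-3)*b*B + 6*b*A) ((2/3)*g*C + (-8/3)*b*C + 6*b*B + (-10/3)*b*A) ((-5/24)*g*C + (25/24)*b*C + (-10/3)*b*B) (0) 1).trans ?_) <;>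
    ring

lemma poly3 (b g : ℝ) :
    ∫ x in (0:ℝ)..1, ∫ y in (0:ℝ)..(1 - x), ∫ z in (0:ℝ)..(1 - x - y),
      (b * y ^ 2 + (b + g) * y * z + g * z ^ 2
        + 3 / 2 * (b + g) * ((1 - x - y - z) ^ 2 + x ^ 2)
        + (-5 * b - g) * ((1 - x - y - z) + x) * y + (-b - 5 * g) * ((1 - x - y - z) + x) * z
        + 3 * (b + g) * (1 - x - y - z) * x) = 0 := by
  have h1 : ∀ x y : ℝ, ∫ z in (0:ℝ)..(1 - x - y),
      (b * y ^ 2 + (b + g) * y * z + g * z ^ 2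
        + 3 / 2 * (b + g) * ((1 - x - y - z) ^ 2 + x ^ 2)
        + (-5 * b - g) * ((1 - x - y - z) + x) * y + (-b - 5 * g) * ((1 - x - y - z) + x) * z
        + 3 * (b + g) * (1 - x - y - z) * x) = _ := fun x y => by
    refine Eq.trans (intervalIntegral.integral_congr fun z _ => ?_) (int1
      ((3/2)*g + (3/2)*b + (-4)*y*g + (-8)*y*b + (5/2)*y^2*g + (15/2)*y^2*b) ((-8)*g + (-4)*b + 10*y*g + 10*y*b) ((15/2)*g + (5/2)*b) (0) (0) (0) (1 - x - y))
    ring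
  simp only [h1]
  refine Eq.trans (intervalIntegral.integral_congr fun x _ =>
    Eq.trans (intervalIntegral.integral_congr fun y _ => ?_) (int1
      ((1/3)*b + (-1)*x*g + (7/2)*x^2*g + (1/2)*x^2*b + (-5/2)*x^3*g + (-5/6)*x^3*b) ((-3)*b + 1*x*g + (-1)*x*b + (-5/2)*x^2*g + (5/2)*x^2*b) (6*b) ((-10/3)*b) (0) (0) (1 - x))) ?_
  · ring
  refine Eq.trans (intervalIntegral.integral_congr fun x _ => ?_) ((int1
      (0) ((-1/2)*g + (-1/2)*b) ((9/4)*g + (9/4)*b) ((-3)*g + (-3)*b) ((5/4)*g + (5/4)*b) (0) 1).trans ?_) <;>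
    ring

lemma L2_inj (a b c : E3) (r t : E3 →ᵃ[ℝ] ℝ) (ra : r a = 0) (rb : r b = 1) (rc : r c = 0)
    (ta : t a = 0) (tb : t b = 0) (tc : t c = 1) : Function.Injective (L2 a b c) := by
  intro w w' h
  have h1 := q_L2 r a b c w
  have h2 := q_L2 t a b c w
  rw [h, q_L2] at h1 h2
  simp only [ra, rb, rc, ta, tb, tc] at h1 h2
  exact Prod.ext (by linarith) (by linarith)

lemma L3_inj (a b c d : E3) (r t u : E3 →ᵃ[ℝ] ℝ) (ra : r a = 0) (rb : r b = 1) (rc : r c = 0)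
    (rd : r d = 0) (ta : t a = 0) (tb : t b = 0) (tc : t c = 1) (td : t d = 0)
    (ua : u a = 0) (ub : u b = 0) (uc : u c = 0) (ud : u d = 1) :
    Function.Injective (L3 a b c d) := by
  intro w w' h
  have h1 := q_L3 r a b c d w
  have h2 := q_L3 t a b c d w
  have h3 := q_L3 u a b c d w
  rw [h, q_L3] at h1 h2 h3
  simp only [ra, rb, rc, rd, ta, tb, tc, td, ua, ub, uc, ud] at h1 h2 h3
  exact Prod.ext (by linarith) (Prod.ext (by linarith) (by linarith))

lemma fin2 (a b c : E3) (K : Set (ℝ × ℝ)) (hK : IsCompact K) :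
    (μH[2] : Measure E3) ((fun w => a + L2 a b c w) '' K) < ⊤ := by
  have h := (LipschitzWith.const (α := ℝ × ℝ) a).add (L2 a b c).toContinuousLinearMap.lipschitz
  refine (h.hausdorffMeasure_image_le (d := 2) (by norm_num) K).trans_lt ?_
  rw [hausdorffMeasure_prod_real]
  exact ENNReal.mul_lt_top (ENNReal.rpow_lt_top_of_nonneg (by norm_num) ENNReal.coe_ne_top)
    hK.measure_lt_top

lemma face_int (v : Fin 4 → E3) (lam : Fin 4 → (E3 →ᵃ[ℝ] ℝ))
    (hlam : ∀ i j : Fin 4, lam i (v j) = if i = j then 1 else 0)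
    (i j k l : Fin 4) (hij : i ≠ j) (hki : k ≠ i) (hkj : k ≠ j)
    (hli : l ≠ i) (hlj : l ≠ j) (hkl : k ≠ l) (β γ : ℝ)
    (p : E3 → ℝ)
    (hp : ∀ x, p x =
      β * (lam k x) ^ 2 + (β + γ) * (lam k x) * (lam l x) + γ * (lam l x) ^ 2
      + 3 / 2 * (β + γ) * ((lam i x) ^ 2 + (lam j x) ^ 2)
      + (-5 * β - γ) * ((lam i x) + (lam j x)) * (lam k x)
      + (-β - 5 * γ) * ((lam i x) + (lam j x)) * (lam l x)
      + 3 * (β + γ) * (lam i x) * (lam j x)) (q : E3 →ᵃ[ℝ] ℝ) :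
    ∫ x in Face v i, p x * q x ∂μH[2] = 0 := by
  have hF : Face v i = (fun w => v j + L2 (v j) (v k) (v l) w) '' T2 1 := by
    rw [image2, Face]
    congr 1
    have : {m : Fin 4 | m ≠ i} = {j, k, l} := by
      ext m
      simp only [Set.mem_ofPred_eq, Set.mem_insert_iff, Set.mem_singleton_iff]
      omega
    rw [this]; simp [Set.image_insert_eq]
  rw [hF]
  refine key volume μH[2] (L2 (v j) (v k) (v l)) (v j)
    (L2_inj _ _ _ (lam k) (lam l) ?_ ?_ ?_ ?_ ?_ ?_) (fin2 _ _ _) (T2 1)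
    (fun x => p x * q x) ?_
  any_goals simp [hlam, hkj, hkl, hlj, hkl.symm]
  simp only [hp, q_L2, hlam]
  simp only [hij, hki.symm, hli.symm, hij.symm, hkj, hkj.symm, hlj, hlj.symm, hkl, hkl.symm,
    if_true, if_false]
  rw [int2 1 zero_le_one _ (by fun_prop)]
  refine Eq.trans ?_ (poly2 β γ (q (v j)) (q (v k) - q (v j)) (q (v l) - q (v j)))
  refine intervalIntegral.integral_congr fun x _ => ?_
  refine intervalIntegral.integral_congr fun y _ => ?_
  ring

lemma tet_int (v : Fin 4 → E3) (lam : Fin 4 → (E3 →ᵃ[ℝ] ℝ))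
    (hlam : ∀ i j : Fin 4, lam i (v j) = if i = j then 1 else 0)
    (i j k l : Fin 4) (hij : i ≠ j) (hki : k ≠ i) (hkj : k ≠ j)
    (hli : l ≠ i) (hlj : l ≠ j) (hkl : k ≠ l) (β γ : ℝ)
    (p : E3 → ℝ)
    (hp : ∀ x, p x =
      β * (lam k x) ^ 2 + (β + γ) * (lam k x) * (lam l x) + γ * (lam l x) ^ 2
      + 3 / 2 * (β + γ) * ((lam i x) ^ 2 + (lam j x) ^ 2)
      + (-5 * β - γ) * ((lam i x) + (lam j x)) * (lam k x)
      + (-β - 5 * γ) * ((lam i x) + (lam j x)) * (lam l x)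
      + 3 * (β + γ) * (lam i x) * (lam j x)) :
    ∫ x in Tet v, p x = 0 := by
  have hF : Tet v = (fun w => v i + L3 (v i) (v j) (v k) (v l) w) '' T3 := by
    rw [image3, Tet]
    congr 1
    have : (Set.univ : Set (Fin 4)) = {i, j, k, l} := by
      ext m
      simp only [Set.mem_univ, Set.mem_insert_iff, Set.mem_singleton_iff, true_iff]
      omega
    rw [← Set.image_univ, this]; simp [Set.image_insert_eq]
  rw [hF]
  refine key volume volume (L3 (v i) (v j) (v k) (v l)) (v i)
    (L3_inj _ _ _ _ (lam j) (lam k) (lam l) ?_ ?_ ?_ ?_ ?_ ?_ ?_ ?_ ?_ ?_ ?_ ?_)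
    (fun K hK => (hK.image ?_).measure_lt_top) T3 p ?_
  any_goals simp [hlam, hij.symm, hki, hli, hkj, hkj.symm, hkl, hlj, hlj.symm, hkl.symm]
  · exact continuous_const.add (LinearMap.continuous_of_finiteDimensional _)
  simp only [hp, q_L3, hlam]
  simp only [hij, hki, hli, hki.symm, hli.symm, hij.symm, hkj, hkj.symm, hlj, hlj.symm, hkl,
    hkl.symm, if_true, if_false]
  rw [int3 _ (by fun_prop)]
  refine Eq.trans ?_ (poly3 β γ)
  refine intervalIntegral.integral_congr fun x _ => ?_
  refine intervalIntegral.integral_congr fun y _ => ?_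
  refine intervalIntegral.integral_congr fun z _ => ?_
  ring

/-- The explicit quadratic polynomial of Lemma 3.1, written in barycentric
coordinates, satisfies conditions (1)–(4) and has the stated vertex values. -/
theorem stmt_1 (v : Fin 4 → E3) (hv : AffineIndependent ℝ v)
    (lam : Fin 4 → (E3 →ᵃ[ℝ] ℝ))
    (hlam : ∀ i j : Fin 4, lam i (v j) = if i = j then 1 else 0)
    (i j k l : Fin 4) (hij : i ≠ j) (hki : k ≠ i) (hkj : k ≠ j)
    (hli : l ≠ i) (hlj : l ≠ j) (hkl : k ≠ l) (β γ : ℝ)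
    (p : E3 → ℝ)
    (hp : ∀ x, p x =
      β * (lam k x) ^ 2 + (β + γ) * (lam k x) * (lam l x) + γ * (lam l x) ^ 2
      + 3 / 2 * (β + γ) * ((lam i x) ^ 2 + (lam j x) ^ 2)
      + (-5 * β - γ) * ((lam i x) + (lam j x)) * (lam k x)
      + (-β - 5 * γ) * ((lam i x) + (lam j x)) * (lam l x)
      + 3 * (β + γ) * (lam i x) * (lam j x)) :
    AffineOn (Edge v k l) p ∧
    p (v k) = β ∧ p (v l) = γ ∧
    (∀ q : E3 →ᵃ[ℝ] ℝ, ∫ x in Face v i, p x * q x ∂μH[2] = 0) ∧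
    (∀ q : E3 →ᵃ[ℝ] ℝ, ∫ x in Face v j, p x * q x ∂μH[2] = 0) ∧
    (∫ x in Tet v, p x) = 0 ∧
    p (v i) = 3 * (β + γ) / 2 ∧ p (v j) = 3 * (β + γ) / 2 := by
  have hv1 : ∀ m, lam m (v m) = 1 := fun m => by simp [hlam]
  have hv0 : ∀ m n, m ≠ n → lam m (v n) = 0 := fun m n h => by simp [hlam, h]
  refine ⟨⟨β • lam k + γ • lam l, ?_⟩, ?_, ?_,
    face_int v lam hlam i j k l hij hki hkj hli hlj hkl β γ p hp,
    face_int v lam hlam j i k l hij.symm hkj hki hlj hli hkl β γ p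
      (fun x => by rw [hp x]; ring),
    tet_int v lam hlam i j k l hij hki hkj hli hlj hkl β γ p hp, ?_, ?_⟩
  · rintro x ⟨a, b, ha, hb, hab, rfl⟩
    have hq : ∀ q : E3 →ᵃ[ℝ] ℝ, q (a • v k + b • v l) = a * q (v k) + b * q (v l) := fun q => by
      simpa using Convex.combo_affine_apply (f := q) (x := v k) (y := v l) hab
    simp only [hp, AffineMap.coe_add, AffineMap.coe_smul, Pi.add_apply, Pi.smul_apply, smul_eq_mul,
      hq, hv1, hv0 k l hkl, hv0 l k hkl.symm, hv0 i k hki.symm, hv0 i l hli.symm,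
      hv0 j k hkj.symm, hv0 j l hlj.symm]
    have : a = 1 - b := by linarith
    subst this; ring
  · rw [hp, hv1, hv0 l k hkl.symm, hv0 i k hki.symm, hv0 j k hkj.symm]; ring
  · rw [hp, hv1, hv0 k l hkl, hv0 i l hli.symm, hv0 j l hlj.symm]; ring
  · rw [hp, hv1, hv0 k i hki, hv0 l i hli, hv0 j i hij.symm]; ring
  · rw [hp, hv1, hv0 k j hkj, hv0 l j hlj, hv0 i j hij]; ring
end
end

section
/- Let K be a nondegenerate tetrahedron in ℝ³. Then the real vector space Σ_K has dimension exactly 42. -/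
open MeasureTheory RealInnerProductSpace Matrix

noncomputable section

/-- `p` is (the restriction of) a real polynomial of total degree ≤ k on ℝ³. -/
def IsPolyLE (k : ℕ) (p : E3 → ℝ) : Prop :=
  ∃ P : MvPolynomial (Fin 3) ℝ, P.totalDegree ≤ k ∧ ∀ x, p x = MvPolynomial.eval (fun i => x i) P

/-- The matrix of the orthogonal projection `Q_u = I - u uᵀ` onto the plane `u^⊥`. -/
def Qmat (u : E3) : Matrix (Fin 3) (Fin 3) ℝ :=
  1 - Matrix.vecMulVec (fun i => u i) (fun i => u i)

/-- Membership in the shape-function space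
`Σ_K = {σ ∈ P₂(K;𝕊) : Q_{s_e} σ Q_{s_e}|_e ∈ P₁(e;𝕊) for every edge e of K}`. -/
def MemSigmaK (v : Fin 4 → E3) (σ : E3 → Matrix (Fin 3) (Fin 3) ℝ) : Prop :=
  (∀ i j : Fin 3, IsPolyLE 2 (fun x => σ x i j)) ∧
  (∀ x ∈ Tet v, (σ x).IsSymm) ∧
  (∀ k l : Fin 4, k ≠ l → ∀ s : E3, ‖s‖ = 1 → (∃ c : ℝ, v l - v k = c • s) →
    ∀ i j : Fin 3, AffineOn (Edge v k l) (fun x => (Qmat s * σ x * Qmat s) i j))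

def ea : Fin 6 → Fin 4 := ![0,0,0,1,1,2]
def eb : Fin 6 → Fin 4 := ![1,2,3,2,3,3]

def symM (a : Fin 6 → ℝ) : Matrix (Fin 3) (Fin 3) ℝ :=
  !![a 0, a 1, a 2; a 1, a 3, a 4; a 2, a 4, a 5]

def dwM (d w : Fin 3 → ℝ) : Matrix (Fin 3) (Fin 3) ℝ :=
  Matrix.vecMulVec d w + Matrix.vecMulVec w d

lemma symM_isSymm (a) : (symM a).IsSymm := by
  apply Matrix.IsSymm.ext
  intro i j
  fin_cases i <;> fin_cases j <;> simp [symM]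

lemma dwM_isSymm (d w) : (dwM d w).IsSymm := by
  apply Matrix.IsSymm.ext
  intro i j
  simp [dwM, Matrix.vecMulVec_apply]; ring

lemma symM_inj {a} (h : symM a = 0) : a = 0 := by
  have h' := fun i j => congrFun (congrFun h i) j
  ext m
  fin_cases m
  · simpa [symM] using h' 0 0
  · simpa [symM] using h' 0 1
  · simpa [symM] using h' 0 2
  · simpa [symM] using h' 1 1
  · simpa [symM] using h' 1 2
  · simpa [symM] using h' 2 2

lemma symM_surj {A : Matrix (Fin 3) (Fin 3) ℝ} (h : A.IsSymm) : ∃ a, A = symM a := by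
  refine ⟨![A 0 0, A 0 1, A 0 2, A 1 1, A 1 2, A 2 2], ?_⟩
  have h' := fun i j => h.apply i j
  ext i j
  fin_cases i <;> fin_cases j <;> simp [symM, h' 0 1, h' 0 2, h' 1 2]

lemma dwM_inj {d w : Fin 3 → ℝ} (hd : d ≠ 0) (h : dwM d w = 0) : w = 0 := by
  have h' : ∀ i j, d i * w j + w i * d j = 0 := fun i j => by
    simpa [dwM, Matrix.vecMulVec_apply] using congrFun (congrFun h i) j
  obtain ⟨i, hi⟩ := Function.ne_iff.mp hd
  have hi' : d i ≠ 0 := hi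
  have hwi : w i = 0 := by
    have := h' i i
    have h2 : d i * w i = 0 := by linarith
    exact (mul_eq_zero.mp h2).resolve_left hi'
  ext j
  have := h' i j
  rw [hwi] at this
  have h2 : d i * w j = 0 := by linarith
  exact (mul_eq_zero.mp h2).resolve_left hi'

lemma Q_dw {s : E3} (hs : ‖s‖ = 1) (c : ℝ) (w : Fin 3 → ℝ) (i j) :
    (Qmat s * dwM (fun m => c * s m) w * Qmat s) i j = 0 := by
  have hn : s 0 ^ 2 + s 1 ^ 2 + s 2 ^ 2 = 1 := by
    have := EuclideanSpace.real_norm_sq_eq s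
    rw [hs, Fin.sum_univ_three] at this
    linarith
  have h1 : (Qmat s) *ᵥ (fun m => c * s m) = 0 := by
    ext i
    simp only [Matrix.mulVec, dotProduct, Fin.sum_univ_three, Qmat, Matrix.sub_apply,
      Matrix.vecMulVec_apply]
    fin_cases i <;> simp [Matrix.one_apply]
    · linear_combination (-c * s 0) * hn
    · linear_combination (-c * s 1) * hn
    · linear_combination (-c * s 2) * hn
  have h2 : (fun m => c * s m) ᵥ* (Qmat s) = 0 := by
    have : (Qmat s)ᵀ = Qmat s := by
      ext i j
      simp [Qmat, Matrix.one_apply, Matrix.vecMulVec_apply, eq_comm, mul_comm]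
    rw [← this, Matrix.vecMul_transpose, h1]
  rw [dwM, Matrix.mul_add, Matrix.add_mul, Matrix.mul_vecMulVec, h1,
    Matrix.mul_assoc (Qmat s) (Matrix.vecMulVec w _), Matrix.vecMulVec_mul, Matrix.vecMulVec_mul, h2]
  simp [Matrix.mul_apply, Matrix.vecMulVec_apply]

lemma Q_ker {s : E3} {C : Matrix (Fin 3) (Fin 3) ℝ} (hC : C.IsSymm)
    (h : Qmat s * C * Qmat s = 0) (c : ℝ) (hc : c ≠ 0) :
    ∃ w, C = dwM (fun m => c * s m) w := by
  let u : Fin 3 → ℝ := fun i => s i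
  have h1 : ∀ i j, C i j = u i * (C *ᵥ u) j + (C *ᵥ u) i * u j - (u ⬝ᵥ (C *ᵥ u)) * u i * u j := by
    intro i j
    have := congrFun (congrFun h i) j
    have e01 := hC.apply 0 1
    have e02 := hC.apply 0 2
    have e12 := hC.apply 1 2
    simp only [Matrix.mul_apply, Fin.sum_univ_three, Qmat, Matrix.sub_apply,
      Matrix.vecMulVec_apply, Matrix.zero_apply] at this
    simp only [Matrix.mulVec, dotProduct, Fin.sum_univ_three, u]
    fin_cases i <;> fin_cases j <;> simp [Matrix.one_apply] at this ⊢ <;>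
      rw [e01, e02, e12] at this <;> (try rw [e01]) <;> (try rw [e02]) <;> (try rw [e12]) <;>
      linear_combination this
  refine ⟨fun j => c⁻¹ * ((C *ᵥ u) j - (u ⬝ᵥ (C *ᵥ u)) / 2 * u j), ?_⟩
  ext i j
  rw [h1 i j]
  simp only [dwM, Matrix.add_apply, Matrix.vecMulVec_apply]
  change _ = c * u i * _ + _ * (c * u j)
  field_simp
  ring

/-- span of products of two affine functions -/
inductive QuadP : (E3 → ℝ) → Prop
  | prod (f g : E3 →ᵃ[ℝ] ℝ) : QuadP (fun x => f x * g x)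
  | add {p q} : QuadP p → QuadP q → QuadP (fun x => p x + q x)
  | smul (c : ℝ) {p} : QuadP p → QuadP (fun x => c * p x)

lemma QuadP.zero : QuadP (fun _ => 0) := by
  simpa using QuadP.prod 0 0

lemma QuadP.mono (a b c : ℕ) (h : a + b + c ≤ 2) :
    QuadP (fun x => x 0 ^ a * x 1 ^ b * x 2 ^ c) := by
  let X : Fin 3 → (E3 →ᵃ[ℝ] ℝ) := fun i =>
    (EuclideanSpace.proj i : E3 →L[ℝ] ℝ).toLinearMap.toAffineMap
  let o : E3 →ᵃ[ℝ] ℝ := AffineMap.const ℝ E3 1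
  have hX : ∀ i x, X i x = x i := fun i x => rfl
  have ho : ∀ x, o x = 1 := fun x => rfl
  have key : ∀ f g : E3 →ᵃ[ℝ] ℝ, (∀ x : E3, x 0 ^ a * x 1 ^ b * x 2 ^ c = f x * g x) →
      QuadP (fun x => x 0 ^ a * x 1 ^ b * x 2 ^ c) := by
    intro f g h
    have : (fun x : E3 => x 0 ^ a * x 1 ^ b * x 2 ^ c) = fun x => f x * g x := funext h
    rw [this]; exact QuadP.prod f g
  have ha : a ≤ 2 := by omega
  have hb : b ≤ 2 := by omega
  have hc : c ≤ 2 := by omega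
  interval_cases a <;> interval_cases b <;> interval_cases c <;> first
    | omega
    | exact key o o (fun x => by simp only [hX, ho]; ring1)
    | exact key (X 0) o (fun x => by simp only [hX, ho]; ring1)
    | exact key (X 1) o (fun x => by simp only [hX, ho]; ring1)
    | exact key (X 2) o (fun x => by simp only [hX, ho]; ring1)
    | exact key (X 0) (X 0) (fun x => by simp only [hX, ho]; ring1)
    | exact key (X 0) (X 1) (fun x => by simp only [hX, ho]; ring1)
    | exact key (X 0) (X 2) (fun x => by simp only [hX, ho]; ring1)
    | exact key (X 1) (X 1) (fun x => by simp only [hX, ho]; ring1)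
    | exact key (X 1) (X 2) (fun x => by simp only [hX, ho]; ring1)
    | exact key (X 2) (X 2) (fun x => by simp only [hX, ho]; ring1)

lemma IsPolyLE.quad {p : E3 → ℝ} (h : IsPolyLE 2 p) : QuadP p := by
  obtain ⟨P, hP, hp⟩ := h
  have : p = fun x => ∑ d ∈ P.support, P.coeff d * (x 0 ^ d 0 * x 1 ^ d 1 * x 2 ^ d 2) := by
    ext x
    rw [hp, MvPolynomial.eval_eq']
    simp [Fin.prod_univ_three]
  rw [this]
  have hd : ∀ d ∈ P.support, d 0 + d 1 + d 2 ≤ 2 := by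
    intro d hd
    have h1 := (MvPolynomial.le_totalDegree hd).trans hP
    rw [Finsupp.sum_fintype _ _ (fun _ => rfl), Fin.sum_univ_three] at h1
    exact h1
  generalize P.support = S at hd
  induction S using Finset.induction_on with
  | empty => simpa using QuadP.zero
  | insert a S ha ih =>
    simp only [Finset.sum_insert ha]
    exact ((QuadP.mono _ _ _ (hd a (Finset.mem_insert_self _ _))).smul _).add
      (ih fun d h => hd d (Finset.mem_insert_of_mem h))

lemma IsPolyLE.add {k} {p q : E3 → ℝ} (hp : IsPolyLE k p) (hq : IsPolyLE k q) :
    IsPolyLE k (fun x => p x + q x) := by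
  obtain ⟨P, h1, h2⟩ := hp
  obtain ⟨Q, h3, h4⟩ := hq
  refine ⟨P + Q, (MvPolynomial.totalDegree_add _ _).trans (max_le h1 h3), fun x => ?_⟩
  simp only [h2, h4, map_add]

lemma IsPolyLE.mul {k l} {p q : E3 → ℝ} (hp : IsPolyLE k p) (hq : IsPolyLE l q) :
    IsPolyLE (k + l) (fun x => p x * q x) := by
  obtain ⟨P, h1, h2⟩ := hp
  obtain ⟨Q, h3, h4⟩ := hq
  refine ⟨P * Q, (MvPolynomial.totalDegree_mul _ _).trans (add_le_add h1 h3), fun x => ?_⟩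
  simp only [h2, h4, map_mul]

lemma IsPolyLE.const (k) (c : ℝ) : IsPolyLE k (fun _ => c) :=
  ⟨MvPolynomial.C c, by simp, by simp⟩

lemma IsPolyLE.sum {k} {ι : Type*} (S : Finset ι) {p : ι → E3 → ℝ} (hp : ∀ i, IsPolyLE k (p i)) :
    IsPolyLE k (fun x => ∑ i ∈ S, p i x) := by
  classical
  induction S using Finset.induction_on with
  | empty => simpa using IsPolyLE.const k 0
  | insert a S ha ih =>
    simp only [Finset.sum_insert ha]
    exact (hp a).add ih

lemma IsPolyLE.mono {k l} (h : k ≤ l) {p : E3 → ℝ} (hp : IsPolyLE k p) : IsPolyLE l p := by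
  obtain ⟨P, h1, h2⟩ := hp
  exact ⟨P, h1.trans h, h2⟩

lemma isPoly_affine (f : E3 →ᵃ[ℝ] ℝ) : IsPolyLE 1 f := by
  have h : (f : E3 → ℝ) = fun x => (∑ i, x i * f.linear (EuclideanSpace.single i 1)) + f 0 := by
    ext x
    have h1 := congrFun f.decomp x
    simp only [Pi.add_apply] at h1
    rw [h1]
    congr 1
    have hx : x = ∑ i, x i • (EuclideanSpace.single i (1:ℝ) : E3) := by
      ext j
      fin_cases j <;> simp [Fin.sum_univ_three]
    conv_lhs => rw [hx]
    simp
  rw [h]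
  refine IsPolyLE.add (IsPolyLE.sum _ fun i => ?_) (IsPolyLE.const _ _)
  have : IsPolyLE 1 (fun x : E3 => x i) := ⟨MvPolynomial.X i, by simp, by simp⟩
  exact IsPolyLE.mul (k := 1) (l := 0) this (IsPolyLE.const _ _)

section
variable (b : AffineBasis (Fin 4) ℝ E3)

def mid (e : Fin 6) : E3 := midpoint ℝ (b (ea e)) (b (eb e))

def phi : ((Fin 4 → Fin 6 → ℝ) × (Fin 6 → Fin 3 → ℝ)) →ₗ[ℝ] (E3 → Matrix (Fin 3) (Fin 3) ℝ) where
  toFun aw := fun x => ∑ i, b.coord i x • symM (aw.1 i) +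
    ∑ e, (b.coord (ea e) x * b.coord (eb e) x) •
      dwM (fun m => (b (eb e) - b (ea e)) m) (aw.2 e)
  map_add' p q := by
    have h1 : ∀ a a', symM (a + a') = symM a + symM a' := by
      intro a a'; ext i j; fin_cases i <;> fin_cases j <;> simp [symM]
    have h2 : ∀ d w w', dwM d (w + w') = dwM d w + dwM d w' := by
      intro a a' _; ext i j; simp [dwM, Matrix.vecMulVec_apply]; ring
    ext1 x
    simp only [Prod.fst_add, Prod.snd_add, Pi.add_apply, h1, h2, smul_add, Finset.sum_add_distrib]
    abel
  map_smul' c p := by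
    have h1 : ∀ a, symM (c • a) = c • symM a := by
      intro a; ext i j; fin_cases i <;> fin_cases j <;> simp [symM]
    have h2 : ∀ d w, dwM d (c • w) = c • dwM d w := by
      intro a a'; ext i j; simp [dwM, Matrix.vecMulVec_apply]; ring
    ext1 x
    simp only [Prod.smul_fst, Prod.smul_snd, Pi.smul_apply, h1, h2, smul_add, Finset.smul_sum,
      RingHom.id_apply]
    congr 1 <;> refine Finset.sum_congr rfl fun i _ => smul_comm _ _ _

lemma phi_apply (aw x) : phi b aw x = ∑ i, b.coord i x • symM (aw.1 i) +
    ∑ e, (b.coord (ea e) x * b.coord (eb e) x) •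
      dwM (fun m => (b (eb e) - b (ea e)) m) (aw.2 e) := rfl

lemma ea_ne_eb (e) : ea e ≠ eb e := by fin_cases e <;> decide

lemma affine_eq (f : E3 →ᵃ[ℝ] ℝ) (x) : f x = ∑ i, b.coord i x * f (b i) := by
  conv_lhs => rw [← b.affineCombination_coord_eq_self x]
  rw [Finset.map_affineCombination _ _ _ (b.sum_coord_apply_eq_one x),
    Finset.affineCombination_eq_linear_combination _ _ _ (b.sum_coord_apply_eq_one x)]
  simp

lemma affine_mid (f : E3 →ᵃ[ℝ] ℝ) (x y : E3) : f (midpoint ℝ x y) = (f x + f y) / 2 := by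
  rw [AffineMap.map_midpoint, midpoint_eq_smul_add]
  simp; ring

lemma quad_repr {p : E3 → ℝ} (h : QuadP p) (x) :
    p x = ∑ i, b.coord i x * p (b i) + ∑ e, (b.coord (ea e) x * b.coord (eb e) x) *
      (4 * p (mid b e) - 2 * p (b (ea e)) - 2 * p (b (eb e))) := by
  induction h with
  | prod f g =>
    have h1 := b.sum_coord_apply_eq_one x
    simp only [mid, affine_mid]
    rw [affine_eq b f x, affine_eq b g x]
    simp only [Fin.sum_univ_four, Fin.sum_univ_six, ea, eb] at h1 ⊢
    simp
    have h3 : b.coord 3 x = 1 - b.coord 0 x - b.coord 1 x - b.coord 2 x := by linarith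
    rw [h3]
    ring
  | add _ _ hp hq =>
    beta_reduce
    rw [hp, hq]
    simp only [Fin.sum_univ_four, Fin.sum_univ_six]
    ring
  | smul c _ hp =>
    beta_reduce
    rw [hp]
    simp only [Fin.sum_univ_four, Fin.sum_univ_six]
    ring

lemma coord_mid (e f : Fin 6) :
    b.coord (ea e) (mid b f) * b.coord (eb e) (mid b f) = if e = f then 1/4 else 0 := by
  simp only [mid, affine_mid, AffineBasis.coord_apply]
  fin_cases e <;> fin_cases f <;> simp [ea, eb] <;> norm_num

lemma coord_vert (e : Fin 6) (i : Fin 4) :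
    b.coord (ea e) (b i) * b.coord (eb e) (b i) = 0 := by
  simp only [AffineBasis.coord_apply]
  fin_cases e <;> fin_cases i <;> simp [ea, eb]

lemma sub_ne (e : Fin 6) : (fun m => (b (eb e) - b (ea e)) m) ≠ 0 := by
  intro h
  have : b (eb e) - b (ea e) = 0 := by ext m; exact congrFun h m
  exact ea_ne_eb e (b.ind.injective (sub_eq_zero.mp this)).symm

lemma phi_inj : Function.Injective (phi b) := by
  rw [← LinearMap.ker_eq_bot, LinearMap.ker_eq_bot']
  rintro ⟨a, w⟩ h
  have ha : a = 0 := by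
    ext1 i
    apply symM_inj
    have := congrFun h (b i)
    rw [phi_apply] at this
    simp only [coord_vert, zero_smul, Finset.sum_const_zero, add_zero] at this
    simpa [AffineBasis.coord_apply] using this
  have hs : symM 0 = 0 := by ext i j; fin_cases i <;> fin_cases j <;> simp [symM]
  have hw : w = 0 := by
    ext1 e
    apply dwM_inj (sub_ne b e)
    have := congrFun h (mid b e)
    rw [phi_apply] at this
    simpa [coord_mid, ha, hs, ite_smul] using this
  rw [ha, hw]; rfl

lemma phi_mem (aw) : MemSigmaK b (phi b aw) := by
  refine ⟨fun i j => ?_, fun x _ => ?_, ?_⟩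
  · simp only [phi_apply, Matrix.add_apply, Matrix.sum_apply, Matrix.smul_apply, smul_eq_mul]
    refine IsPolyLE.add (IsPolyLE.sum _ fun i => ?_) (IsPolyLE.sum _ fun e => ?_)
    · exact IsPolyLE.mono (by norm_num : 1 + 0 ≤ 2) ((isPoly_affine _).mul (IsPolyLE.const 0 _))
    · exact IsPolyLE.mul (k := 2) (l := 0) ((isPoly_affine _).mul (isPoly_affine _))
        (IsPolyLE.const 0 _)
  · rw [phi_apply]
    apply Matrix.IsSymm.ext
    intro i j
    simp only [Matrix.add_apply, Matrix.sum_apply, Matrix.smul_apply, (symM_isSymm _).apply i j,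
      (dwM_isSymm _ _).apply i j]
  · rintro k l hkl s hs ⟨c, hc⟩ i j
    refine ⟨∑ m, (Qmat s * symM (aw.1 m) * Qmat s) i j • b.coord m, fun x hx => ?_⟩
    have key : ∀ e, (b.coord (ea e) x * b.coord (eb e) x) *
      (Qmat s * dwM (fun m => (b (eb e) - b (ea e)) m) (aw.2 e) * Qmat s) i j = 0 := by
      intro e
      by_cases h1 : ea e = k ∧ eb e = l
      · rw [h1.1, h1.2]
        have : (fun m => (b l - b k) m) = fun m => c * s m := by rw [hc]; rfl
        rw [this, Q_dw hs, mul_zero]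
      by_cases h2 : ea e = l ∧ eb e = k
      · rw [h2.1, h2.2]
        have : (fun m => (b k - b l) m) = fun m => (-c) * s m := by
          rw [← neg_sub, hc]; ext m; simp
        rw [this, Q_dw hs, mul_zero]
      have h0 : ∀ m, m ≠ k → m ≠ l → b.coord m x = 0 := by
        intro m h3 h4
        rw [Edge, segment_eq_image_lineMap] at hx
        obtain ⟨t, -, rfl⟩ := hx
        rw [AffineMap.apply_lineMap]
        simp [AffineBasis.coord_apply, h3, h4]
      have hne := ea_ne_eb e
      have : b.coord (ea e) x = 0 ∨ b.coord (eb e) x = 0 := by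
        by_cases h3 : ea e ≠ k ∧ ea e ≠ l
        · exact Or.inl (h0 _ h3.1 h3.2)
        · right; apply h0
          · intro h; apply h3; refine ⟨fun h' => hne (h'.trans h.symm), fun h' => h2 ⟨h', h⟩⟩
          · intro h; apply h3; refine ⟨fun h' => h1 ⟨h', h⟩, fun h' => hne (h'.trans h.symm)⟩
      rcases this with h | h <;> simp [h]
    simp only [phi_apply, Matrix.mul_add, Matrix.add_mul, Matrix.mul_sum, Matrix.sum_mul,
      Matrix.mul_smul, Matrix.smul_mul, Matrix.add_apply, Matrix.sum_apply, Matrix.smul_apply,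
      smul_eq_mul, key, Finset.sum_const_zero, add_zero]
    rw [Fin.sum_univ_four, Fin.sum_univ_four]
    simp [mul_comm]

lemma mem_range {σ} (h : MemSigmaK b σ) : ∃ aw, phi b aw = σ := by
  obtain ⟨h1, h2, h3⟩ := h
  have hvT : ∀ i, b i ∈ Tet b := fun i => subset_convexHull _ _ ⟨i, rfl⟩
  have hmT : ∀ e, mid b e ∈ Tet b := fun e =>
    (convex_convexHull ℝ _).midpoint_mem (hvT _) (hvT _)
  let C : Fin 6 → Matrix (Fin 3) (Fin 3) ℝ := fun e =>
    (4:ℝ) • σ (mid b e) - (2:ℝ) • σ (b (ea e)) - (2:ℝ) • σ (b (eb e))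
  have hCs : ∀ e, (C e).IsSymm := fun e =>
    (((h2 _ (hmT e)).smul _).sub ((h2 _ (hvT _)).smul _)).sub ((h2 _ (hvT _)).smul _)
  have hw : ∀ e, ∃ w, C e = dwM (fun m => (b (eb e) - b (ea e)) m) w := by
    intro e
    set d := b (eb e) - b (ea e) with hd
    have hd0 : d ≠ 0 := fun h => ea_ne_eb e (b.ind.injective (sub_eq_zero.mp h)).symm
    have hn : ‖d‖ ≠ 0 := norm_ne_zero_iff.mpr hd0
    have hds : d = ‖d‖ • (‖d‖⁻¹ • d) := by rw [smul_smul, mul_inv_cancel₀ hn, one_smul]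
    have hs : ‖‖d‖⁻¹ • d‖ = 1 := by rw [norm_smul, norm_inv, norm_norm, inv_mul_cancel₀ hn]
    have h4 := h3 (ea e) (eb e) (ea_ne_eb e) _ hs ⟨_, hds⟩
    generalize ‖d‖⁻¹ • d = s at hds hs h4
    have hQ : Qmat s * C e * Qmat s = 0 := by
      ext i j
      obtain ⟨q, hq⟩ := h4 i j
      have q1 := hq _ (left_mem_segment ℝ _ _)
      have q2 := hq _ (right_mem_segment ℝ _ _)
      have q3 := hq _ (midpoint_mem_segment _ _)
      rw [affine_mid, ← q1, ← q2] at q3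
      simp only [C, mid, Matrix.mul_sub, Matrix.sub_mul, Matrix.mul_smul, Matrix.smul_mul,
        Matrix.sub_apply, Matrix.smul_apply, smul_eq_mul, Matrix.zero_apply]
      linarith
    obtain ⟨w, hw⟩ := Q_ker (hCs e) hQ _ hn
    refine ⟨w, hw.trans ?_⟩
    congr 1
    ext m
    conv_rhs => rw [hds]
    rfl
  choose w hw using hw
  choose a ha using fun i => symM_surj (h2 _ (hvT i))
  refine ⟨(a, w), ?_⟩
  ext x i j
  rw [quad_repr b (h1 i j).quad x, phi_apply]
  simp only [← hw, ← ha, C, Matrix.add_apply, Matrix.sum_apply, Matrix.smul_apply, smul_eq_mul,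
    Matrix.sub_apply]
end

/-- The space `Σ_K` has dimension exactly 42: it admits a basis of 42 elements,
i.e. a linearly independent family of 42 members of `Σ_K` whose span contains
all of `Σ_K`. -/
theorem stmt_5 (v : Fin 4 → E3) (hv : AffineIndependent ℝ v) :
    ∃ B : Fin 42 → (E3 → Matrix (Fin 3) (Fin 3) ℝ),
      (∀ m, MemSigmaK v (B m)) ∧
      LinearIndependent ℝ B ∧
      ∀ σ : E3 → Matrix (Fin 3) (Fin 3) ℝ, MemSigmaK v σ →
        σ ∈ Submodule.span ℝ (Set.range B) := by
  have hb : affineSpan ℝ (Set.range v) = ⊤ := by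
    rw [hv.affineSpan_eq_top_iff_card_eq_finrank_add_one]
    simp
  let b : AffineBasis (Fin 4) ℝ E3 := ⟨v, hv, hb⟩
  have hfr : Module.finrank ℝ ((Fin 4 → Fin 6 → ℝ) × (Fin 6 → Fin 3 → ℝ)) = 42 := by
    simp [Module.finrank_prod, Module.finrank_pi_fintype]
  let B := Module.finBasisOfFinrankEq ℝ ((Fin 4 → Fin 6 → ℝ) × (Fin 6 → Fin 3 → ℝ)) hfr
  refine ⟨fun m => phi b (B m), fun m => phi_mem b _, ?_, ?_⟩
  · exact B.linearIndependent.map' (phi b) (LinearMap.ker_eq_bot.mpr (phi_inj b))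
  · intro σ hσ
    obtain ⟨aw, rfl⟩ := mem_range b hσ
    have : Set.range (fun m => phi b (B m)) = phi b '' Set.range B := Set.range_comp _ _
    rw [this, ← Submodule.map_span, B.span_eq]
    exact Submodule.mem_map_of_mem Submodule.mem_top
end
end
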